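/- arXiv:2208.11245 — 2 statements merged into one kernel-verified Lean document; each statement's English description precedes it below -/
import Mathlib

section
/- Let Ω ⊆ ℝ^N \ {0} be Lebesgue measurable with |Ω| < ∞ and assume D̄ := dim̄_B(∞,Ω) < −N. Let ‖·‖ be a norm on ℝ^N (i.e. a function satisfying the norm axioms) and let α ∈ (−∞,1) be such that the Euclidean norm and ‖·‖ are equivalent of order α for (∞,Ω), i.e. |x| = ‖x‖ + O(|x|^α) as |x| → +∞ with x ∈ Ω. Then for T > 0 sufficiently large the function s ↦ ∫_{B_T(0)^c ∩ Ω} (|x|^{-s-N} − ‖x‖^{-s-N}) dx is given by an absolutely convergent integral for all s with Re s > D̄ − (1−α), and defines a holomorphic function on the half-plane {Re s > D̄ − (1−α)}; in other words, the difference ζ_{∞,Ω}(·) − ζ_{∞,Ω}(·;‖·‖) of the distance zeta functions at infinity computed with the two norms is holomorphic on (at least) {Re s > D̄ − (1−α)}. -/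
open MeasureTheory Filter Set Complex Topology
open scoped ENNReal Real

noncomputable section

/-- The "tail" of `Ω` beyond radius `t`: the complement of the open Euclidean ball of
radius `t` centered at `0`, intersected with `Ω`. -/
def tailSet (N : ℕ) (Ω : Set (EuclideanSpace ℝ (Fin N))) (t : ℝ) :
    Set (EuclideanSpace ℝ (Fin N)) :=
  {x | x ∈ Ω ∧ t ≤ ‖x‖}

/-- The tube function `t ↦ |_tΩ|` at infinity. -/
def tubeVol (N : ℕ) (Ω : Set (EuclideanSpace ℝ (Fin N))) (t : ℝ) : ℝ :=
  (volume (tailSet N Ω t)).toReal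

/-- Upper `r`-dimensional Minkowski content of `Ω` at infinity. -/
def upperMinkContent (N : ℕ) (Ω : Set (EuclideanSpace ℝ (Fin N))) (r : ℝ) : ℝ≥0∞ :=
  Filter.limsup (fun t : ℝ => volume (tailSet N Ω t) / ENNReal.ofReal (t ^ ((N : ℝ) + r)))
    Filter.atTop

/-- Lower `r`-dimensional Minkowski content of `Ω` at infinity. -/
def lowerMinkContent (N : ℕ) (Ω : Set (EuclideanSpace ℝ (Fin N))) (r : ℝ) : ℝ≥0∞ :=
  Filter.liminf (fun t : ℝ => volume (tailSet N Ω t) / ENNReal.ofReal (t ^ ((N : ℝ) + r)))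
    Filter.atTop

/-- Upper Minkowski dimension of `Ω` at infinity. -/
def upperMinkDim (N : ℕ) (Ω : Set (EuclideanSpace ℝ (Fin N))) : ℝ :=
  sInf {r : ℝ | upperMinkContent N Ω r = 0}

/-- Lower Minkowski dimension of `Ω` at infinity. -/
def lowerMinkDim (N : ℕ) (Ω : Set (EuclideanSpace ℝ (Fin N))) : ℝ :=
  sInf {r : ℝ | lowerMinkContent N Ω r = 0}

/-- Distance (Lapidus) zeta function of `Ω` at infinity. -/
def distZeta (N : ℕ) (Ω : Set (EuclideanSpace ℝ (Fin N))) (T : ℝ) (s : ℂ) : ℂ :=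
  ∫ x in tailSet N Ω T, (‖x‖ : ℂ) ^ (-s - (N : ℂ))

/-- Tube zeta function of `Ω` at infinity. -/
def tubeZeta (N : ℕ) (Ω : Set (EuclideanSpace ℝ (Fin N))) (T : ℝ) (s : ℂ) : ℂ :=
  ∫ t in Set.Ioi T, (t : ℂ) ^ (-s - (N : ℂ) - 1) * ((tubeVol N Ω t : ℝ) : ℂ)

/-- Abscissa of (absolute) convergence of the distance zeta function at infinity. -/
def distAbscissa (N : ℕ) (Ω : Set (EuclideanSpace ℝ (Fin N))) (T : ℝ) : ℝ :=
  sInf {σ : ℝ | ∀ s : ℂ, σ < s.re →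
    IntegrableOn (fun x => (‖x‖ : ℂ) ^ (-s - (N : ℂ))) (tailSet N Ω T) volume}

/-- Abscissa of (absolute) convergence of the tube zeta function at infinity. -/
def tubeAbscissa (N : ℕ) (Ω : Set (EuclideanSpace ℝ (Fin N))) (T : ℝ) : ℝ :=
  sInf {σ : ℝ | ∀ s : ℂ, σ < s.re →
    IntegrableOn (fun t : ℝ => (t : ℂ) ^ (-s - (N : ℂ) - 1) * ((tubeVol N Ω t : ℝ) : ℂ))
      (Set.Ioi T) volume}

/-- A measurable set stays measurable after removing an open ball around the origin. -/
theorem measurableSet_tailSet {N : ℕ} {Ω : Set (EuclideanSpace ℝ (Fin N))}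
    (hmeas : MeasurableSet Ω) (t : ℝ) : MeasurableSet (tailSet N Ω t) :=
  hmeas.inter (measurableSet_le measurable_const measurable_norm)

/-- If the upper Minkowski dimension at infinity is negative, every exponent above it controls
the volume of the tails. -/
theorem exists_volume_tailSet_le {N : ℕ} {Ω : Set (EuclideanSpace ℝ (Fin N))} {r : ℝ}
    (hneg : upperMinkDim N Ω < 0) (hr : upperMinkDim N Ω < r) :
    ∃ t₀ > (0 : ℝ), ∀ t, t₀ ≤ t →
      volume (tailSet N Ω t) ≤ ENNReal.ofReal (t ^ ((N : ℝ) + r)) := by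
  have hne : {r : ℝ | upperMinkContent N Ω r = 0}.Nonempty := by
    by_contra h
    rw [Set.not_nonempty_iff_eq_empty] at h
    rw [upperMinkDim, h, Real.sInf_empty] at hneg
    exact lt_irrefl _ hneg
  obtain ⟨r₀, hr₀, hlt⟩ := exists_lt_of_csInf_lt hne hr
  have hlim : upperMinkContent N Ω r₀ < 1 := by
    rw [show upperMinkContent N Ω r₀ = 0 from hr₀]
    exact zero_lt_one
  obtain ⟨t₁, ht₁⟩ := eventually_atTop.1 (eventually_lt_of_limsup_lt hlim)
  refine ⟨max t₁ 1, by positivity, fun t ht => ?_⟩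
  have h1 : 1 ≤ t := (le_max_right _ _).trans ht
  have hpos : 0 < t ^ ((N : ℝ) + r₀) := Real.rpow_pos_of_pos (by linarith) _
  have h := (ht₁ t ((le_max_left _ _).trans ht)).le
  rw [ENNReal.div_le_iff (by simpa using hpos) ENNReal.ofReal_ne_top, one_mul] at h
  refine h.trans (ENNReal.ofReal_le_ofReal ?_)
  exact Real.rpow_le_rpow_of_exponent_le h1 (by linarith)

/-- Powers of the norm with exponent below `-(N + D)`, where `D < -N` is the upper Minkowski
dimension at infinity, are integrable on the tails. -/
theorem integrableOn_norm_rpow_tailSet {N : ℕ} {Ω : Set (EuclideanSpace ℝ (Fin N))}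
    (hmeas : MeasurableSet Ω) (hfin : volume Ω < ⊤) (hD : upperMinkDim N Ω < -(N : ℝ))
    {T β : ℝ} (hT : 1 ≤ T) (hβ : β < -((N : ℝ) + upperMinkDim N Ω)) :
    IntegrableOn (fun x => ‖x‖ ^ β) (tailSet N Ω T) volume := by
  obtain ⟨p, hp, hpD⟩ : ∃ p, max β 0 < p ∧ p < -((N : ℝ) + upperMinkDim N Ω) :=
    exists_between (max_lt hβ (by linarith))
  have hp0 : 0 < p := (le_max_right _ _).trans_lt hp
  have hβp : β ≤ p := ((le_max_left _ _).trans_lt hp).le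
  obtain ⟨r, hDr, hrp⟩ : ∃ r, upperMinkDim N Ω < r ∧ r < -(N : ℝ) - p :=
    exists_between (by linarith)
  have hN : (0 : ℝ) ≤ N := Nat.cast_nonneg N
  obtain ⟨t₀, ht₀, hvol⟩ := exists_volume_tailSet_le (by linarith) hDr
  have htail := measurableSet_tailSet hmeas T
  suffices hint : IntegrableOn (fun x => ‖x‖ ^ p) (tailSet N Ω T) volume by
    refine Integrable.mono' hint (measurable_norm.pow_const β).aestronglyMeasurable ?_
    filter_upwards [ae_restrict_mem htail] with x hx
    rw [Real.norm_of_nonneg (by positivity)]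
    exact Real.rpow_le_rpow_of_exponent_le (hT.trans hx.2) hβp
  refine ⟨(measurable_norm.pow_const p).aestronglyMeasurable, ?_⟩
  rw [hasFiniteIntegral_iff_ofReal (ae_of_all _ fun x => by positivity),
    lintegral_rpow_eq_lintegral_meas_le_mul _ (ae_of_all _ fun x => norm_nonneg x)
      (by fun_prop) hp0]
  refine ENNReal.mul_lt_top ENNReal.ofReal_lt_top ?_
  have hlevel (t : ℝ) : (volume.restrict (tailSet N Ω T))
      {x : EuclideanSpace ℝ (Fin N) | t ≤ ‖x‖} ≤ volume (tailSet N Ω t) := by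
    rw [Measure.restrict_apply (measurableSet_le measurable_const measurable_norm)]
    exact measure_mono fun x hx => ⟨hx.2.1, hx.1⟩
  rw [← Ioc_union_Ioi_eq_Ioi ht₀.le]
  refine (lintegral_union_le _ _ _).trans_lt (ENNReal.add_lt_top.2 ⟨?_, ?_⟩)
  · calc
      _ ≤ ∫⁻ t in Ioc 0 t₀, volume Ω * ENNReal.ofReal (t ^ (p - 1)) := by
        refine lintegral_mono fun t => mul_le_mul_left ?_ _
        exact (hlevel t).trans (measure_mono fun x hx => hx.1)
      _ = volume Ω * ∫⁻ t in Ioc 0 t₀, ENNReal.ofReal (t ^ (p - 1)) :=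
        lintegral_const_mul' _ _ hfin.ne
      _ < ⊤ := by
        refine ENNReal.mul_lt_top hfin ?_
        have h := (intervalIntegrable_iff_integrableOn_Ioc_of_le ht₀.le).1
          (intervalIntegral.intervalIntegrable_rpow' (r := p - 1) (a := 0) (b := t₀)
            (by linarith))
        exact h.lintegral_lt_top
  · calc
      _ ≤ ∫⁻ t in Ioi t₀, ENNReal.ofReal (t ^ ((N : ℝ) + r + (p - 1))) := by
        refine setLIntegral_mono' measurableSet_Ioi fun t ht => ?_
        have htpos : 0 < t := ht₀.trans ht
        rw [Real.rpow_add htpos, ENNReal.ofReal_mul (by positivity)]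
        exact mul_le_mul_left ((hlevel t).trans (hvol t (le_of_lt ht))) _
      _ < ⊤ := (integrableOn_Ioi_rpow_of_lt (by linarith) ht₀).lintegral_lt_top

/-- Real powers at comparable points are comparable. -/
theorem Real.rpow_le_two_rpow_abs_mul {a u : ℝ} (ha : 0 < a) (hl : a / 2 ≤ u) (hu : u ≤ 2 * a)
    (e : ℝ) : u ^ e ≤ 2 ^ |e| * a ^ e := by
  have hu0 : 0 < u := by linarith
  rcases le_total 0 e with he | he
  · rw [abs_of_nonneg he, ← Real.mul_rpow (by norm_num) ha.le]
    exact Real.rpow_le_rpow hu0.le hu he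
  · calc
      u ^ e ≤ (2⁻¹ * a) ^ e :=
        Real.rpow_le_rpow_of_nonpos (by positivity) (by linarith) he
      _ = 2 ^ |e| * a ^ e := by
        rw [Real.mul_rpow (by norm_num) ha.le, abs_of_nonpos he, Real.inv_rpow (by norm_num),
          Real.rpow_neg (by norm_num)]

/-- Mean value estimate for the difference of complex powers at comparable positive reals. -/
theorem Complex.norm_ofReal_cpow_sub_le {a b : ℝ} (ha : 0 < a) (hl : a / 2 ≤ b) (hu : b ≤ 2 * a)
    (w : ℂ) :
    ‖(a : ℂ) ^ w - (b : ℂ) ^ w‖ ≤ ‖w‖ * (2 ^ |w.re - 1| * a ^ (w.re - 1)) * |a - b| := by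
  rcases eq_or_ne w 0 with rfl | hw
  · simp
  have hderiv : ∀ u ∈ Icc (a / 2) (2 * a),
      HasDerivWithinAt (fun y : ℝ => (y : ℂ) ^ w) (w * (u : ℂ) ^ (w - 1)) (Icc (a / 2) (2 * a)) u :=
    fun u hu => (hasDerivAt_ofReal_cpow_const (by linarith [hu.1] : 0 < u).ne' hw).hasDerivWithinAt
  have hbound : ∀ u ∈ Icc (a / 2) (2 * a),
      ‖w * (u : ℂ) ^ (w - 1)‖ ≤ ‖w‖ * (2 ^ |w.re - 1| * a ^ (w.re - 1)) := by
    intro u hu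
    rw [norm_mul, Complex.norm_cpow_eq_rpow_re_of_pos (by linarith [hu.1]), Complex.sub_re,
      Complex.one_re]
    exact mul_le_mul_of_nonneg_left (Real.rpow_le_two_rpow_abs_mul ha hu.1 hu.2 _)
      (norm_nonneg w)
  exact (convex_Icc _ _).norm_image_sub_le_of_norm_hasDerivWithin_le hderiv hbound
    ⟨hl, hu⟩ ⟨by linarith, by linarith⟩

/-- An integral depending holomorphically on a parameter and locally uniformly dominated by
integrable functions is holomorphic in the parameter. -/
theorem differentiableOn_integral_of_locally_dominated {X : Type*} [MeasurableSpace X]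
    {μ : Measure X} {F F' : ℂ → X → ℂ} {U : Set ℂ}
    (hF : ∀ s, AEStronglyMeasurable (F s) μ) (hF' : ∀ s, AEStronglyMeasurable (F' s) μ)
    (hdiff : ∀ᵐ x ∂μ, ∀ s, HasDerivAt (F · x) (F' s x) s)
    (hdom : ∀ s₀ ∈ U, ∃ ε > (0 : ℝ), ∃ bound : X → ℝ, Integrable bound μ ∧
      ∀ᵐ x ∂μ, ∀ s ∈ Metric.ball s₀ ε, ‖F s x‖ ≤ bound x) :
    DifferentiableOn ℂ (fun s => ∫ x, F s x ∂μ) U := by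
  intro s₀ hs₀
  obtain ⟨ε, hε, bound, hint, hle⟩ := hdom s₀ hs₀
  refine (hasDerivAt_integral_of_dominated_loc_of_deriv_le (F' := F')
    (bound := fun x => bound x / (ε / 3)) (Metric.ball_mem_nhds s₀ (by positivity : 0 < ε / 3))
    (Eventually.of_forall hF) ?_ (hF' s₀) ?_ (hint.div_const _)
    (hdiff.mono fun x hx s _ => hx s)).2.differentiableAt.differentiableWithinAt
  · exact hint.mono' (hF s₀) (hle.mono fun x hx => hx s₀ (Metric.mem_ball_self hε))
  · filter_upwards [hdiff, hle] with x hx hb s hs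
    rw [← (hx s).deriv]
    refine Complex.norm_deriv_le_of_forall_mem_sphere_norm_le (by positivity)
      (Differentiable.diffContOnCl fun z => (hx z).differentiableAt) fun z hz => hb z ?_
    rw [Metric.mem_ball] at hs ⊢
    rw [Metric.mem_sphere] at hz
    linarith [dist_triangle z s s₀]

/-- A subadditive, absolutely homogeneous function on a finite-dimensional space is continuous. -/
theorem continuous_of_subadditive_of_homogeneous {E : Type*} [NormedAddCommGroup E]
    [NormedSpace ℝ E] [FiniteDimensional ℝ E] {q : E → ℝ}
    (hq_add : ∀ x y, q (x + y) ≤ q x + q y)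
    (hq_smul : ∀ (c : ℝ) x, q (c • x) = |c| * q x) : Continuous q := by
  have hconv : ConvexOn ℝ univ q := by
    refine ⟨convex_univ, fun x _ y _ a b ha hb _ => ?_⟩
    refine (hq_add _ _).trans_eq ?_
    rw [hq_smul, hq_smul, abs_of_nonneg ha, abs_of_nonneg hb, smul_eq_mul, smul_eq_mul]
  exact continuousOn_univ.1 (hconv.continuousOn isOpen_univ)

/-- An error term `c * t ^ α` with `α < 1` is eventually at most `t / 2`. -/
theorem exists_mul_rpow_le_half {α : ℝ} (hα : α < 1) (c : ℝ) :
    ∃ t₀ : ℝ, ∀ t, t₀ ≤ t → c * t ^ α ≤ t / 2 := by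
  have h : Tendsto (fun t : ℝ => c * t ^ (-(1 - α))) atTop (𝓝 (c * 0)) :=
    (tendsto_rpow_neg_atTop (by linarith)).const_mul c
  rw [mul_zero] at h
  obtain ⟨t₀, ht₀⟩ := eventually_atTop.1
    ((h.eventually_lt_const (by norm_num : (0 : ℝ) < 1 / 2)).and (eventually_gt_atTop 0))
  refine ⟨t₀, fun t ht => ?_⟩
  obtain ⟨hlt, hpos⟩ := ht₀ t ht
  calc
    c * t ^ α = c * t ^ (-(1 - α)) * t := by
      rw [mul_assoc, ← Real.rpow_add_one hpos.ne']
      ring_nf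
    _ ≤ 1 / 2 * t := mul_le_mul_of_nonneg_right hlt.le hpos.le
    _ = t / 2 := by ring

/-- behavior of the distance zeta function at infinity under a change of
norm. If a norm `q` on `ℝ^N` is equivalent of order `α < 1` to the Euclidean norm for
`(∞,Ω)` and `D̄ := dim̄_B(∞,Ω) < −N`, then for all sufficiently large `T > 0` the
difference of the two distance zeta functions is given by an absolutely convergent
integral and is holomorphic on the half-plane `{Re s > D̄ − (1−α)}`. -/
theorem change_of_norm_holomorphic_difference
    (N : ℕ) (Ω : Set (EuclideanSpace ℝ (Fin N)))
    (hmeas : MeasurableSet Ω) (hfin : volume Ω < ⊤)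
    (h0 : ∀ x ∈ Ω, x ≠ 0)
    (hD : upperMinkDim N Ω < -(N : ℝ))
    (q : EuclideanSpace ℝ (Fin N) → ℝ)
    (hq_add : ∀ x y, q (x + y) ≤ q x + q y)
    (hq_smul : ∀ (c : ℝ) x, q (c • x) = |c| * q x)
    (hq_zero : ∀ x, q x = 0 ↔ x = 0)
    (α : ℝ) (hα : α < 1)
    (hequiv : ∃ c > (0 : ℝ), ∃ R > (0 : ℝ), ∀ x ∈ Ω, R ≤ ‖x‖ →
      |‖x‖ - q x| ≤ c * ‖x‖ ^ α) :
    ∃ T₀ > (0 : ℝ), ∀ T : ℝ, T₀ ≤ T →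
      (∀ s : ℂ, upperMinkDim N Ω - (1 - α) < s.re →
        IntegrableOn
          (fun x => (‖x‖ : ℂ) ^ (-s - (N : ℂ)) - ((q x : ℝ) : ℂ) ^ (-s - (N : ℂ)))
          (tailSet N Ω T) volume) ∧
      DifferentiableOn ℂ
        (fun s : ℂ => ∫ x in tailSet N Ω T,
          ((‖x‖ : ℂ) ^ (-s - (N : ℂ)) - ((q x : ℝ) : ℂ) ^ (-s - (N : ℂ))))
        {s : ℂ | upperMinkDim N Ω - (1 - α) < s.re} := by
  obtain ⟨c, hc, R, hR, hequiv⟩ := hequiv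
  obtain ⟨t₀, ht₀⟩ := exists_mul_rpow_le_half hα c
  have hqc : Continuous q := continuous_of_subadditive_of_homogeneous hq_add hq_smul
  refine ⟨max (max R 1) t₀, by positivity, fun T hT => ?_⟩
  have hRT : R ≤ T := ((le_max_left _ _).trans (le_max_left _ _)).trans hT
  have h1T : 1 ≤ T := ((le_max_right _ _).trans (le_max_left _ _)).trans hT
  have htT : t₀ ≤ T := (le_max_right _ _).trans hT
  have htail := measurableSet_tailSet hmeas T
  have hcomp : ∀ x ∈ tailSet N Ω T, 1 ≤ ‖x‖ ∧ ‖x‖ / 2 ≤ q x ∧ q x ≤ 2 * ‖x‖ ∧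
      |‖x‖ - q x| ≤ c * ‖x‖ ^ α := by
    intro x hx
    have hnorm : 1 ≤ ‖x‖ := h1T.trans hx.2
    have hle := hequiv x hx.1 (hRT.trans hx.2)
    have hhalf := abs_le.1 (hle.trans (ht₀ ‖x‖ (htT.trans hx.2)))
    exact ⟨hnorm, by linarith [hhalf.2], by linarith [hhalf.1], hle⟩
  set F : ℂ → EuclideanSpace ℝ (Fin N) → ℂ := fun s x =>
    (‖x‖ : ℂ) ^ (-s - (N : ℂ)) - ((q x : ℝ) : ℂ) ^ (-s - (N : ℂ))
  have hqm : Measurable q := hqc.measurable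
  have hFm (s : ℂ) : AEStronglyMeasurable (F s) (volume.restrict (tailSet N Ω T)) :=
    Measurable.aestronglyMeasurable (by fun_prop)
  have hdom : ∀ s₀ ∈ {s : ℂ | upperMinkDim N Ω - (1 - α) < s.re},
      ∃ ε > (0 : ℝ), ∃ bound : EuclideanSpace ℝ (Fin N) → ℝ,
        IntegrableOn bound (tailSet N Ω T) volume ∧
        ∀ᵐ x ∂(volume.restrict (tailSet N Ω T)), ∀ s ∈ Metric.ball s₀ ε, ‖F s x‖ ≤ bound x := by
    intro s₀ hs₀
    obtain ⟨σ, hσD, hσ⟩ := exists_between (Set.mem_ofPred_eq ▸ hs₀)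
    set M : ℝ := ‖s₀‖ + (s₀.re - σ) + N
    refine ⟨s₀.re - σ, by linarith,
      fun x => M * 2 ^ (M + 1) * c * ‖x‖ ^ (-σ - N - 1 + α),
      (integrableOn_norm_rpow_tailSet hmeas hfin hD h1T (by linarith)).const_mul _, ?_⟩
    filter_upwards [ae_restrict_mem htail] with x hx s hs
    obtain ⟨hx1, hl, hu, herr⟩ := hcomp x hx
    have hx0 : 0 < ‖x‖ := by linarith
    rw [mem_ball_iff_norm] at hs
    have hre : σ < s.re := by
      have := (abs_le.1 (Complex.abs_re_le_norm (s - s₀))).1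
      rw [Complex.sub_re] at this
      linarith
    set w : ℂ := -s - (N : ℂ) with hw
    have hwre : w.re = -s.re - N := by simp [hw]
    have hwM : ‖w‖ ≤ M := by
      calc
        ‖w‖ ≤ ‖-s‖ + ‖(N : ℂ)‖ := norm_sub_le _ _
        _ = ‖s‖ + N := by rw [norm_neg, Complex.norm_natCast]
        _ ≤ M := by
          have := norm_sub_norm_le s s₀
          simp only [M]
          linarith
    have hM0 : 0 ≤ M := (norm_nonneg w).trans hwM
    have hexp : |w.re - 1| ≤ M + 1 := by
      refine (abs_sub _ _).trans ?_
      rw [abs_one]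
      linarith [Complex.abs_re_le_norm w]
    calc
      ‖F s x‖ ≤ ‖w‖ * (2 ^ |w.re - 1| * ‖x‖ ^ (w.re - 1)) * |‖x‖ - q x| :=
        Complex.norm_ofReal_cpow_sub_le hx0 hl hu w
      _ ≤ M * (2 ^ (M + 1) * ‖x‖ ^ (-σ - N - 1)) * (c * ‖x‖ ^ α) := by
        gcongr
        · norm_num
        · linarith
      _ = M * 2 ^ (M + 1) * c * ‖x‖ ^ (-σ - N - 1 + α) := by
        rw [Real.rpow_add hx0]
        ring
  refine ⟨fun s hs => ?_, ?_⟩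
  · obtain ⟨ε, hε, bound, hint, hle⟩ := hdom s hs
    exact hint.mono' (hFm s) (hle.mono fun x hx => hx s (Metric.mem_ball_self hε))
  · refine differentiableOn_integral_of_locally_dominated (F := F)
      (F' := fun s x => (‖x‖ : ℂ) ^ (-s - (N : ℂ)) * Complex.log ‖x‖ * (-1) -
        ((q x : ℝ) : ℂ) ^ (-s - (N : ℂ)) * Complex.log (q x) * (-1)) hFm
      (fun s => Measurable.aestronglyMeasurable (by fun_prop)) ?_ hdom
    filter_upwards [ae_restrict_mem htail] with x hx s
    obtain ⟨hx1, hl, -, -⟩ := hcomp x hx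
    have hexp : HasDerivAt (fun s : ℂ => -s - (N : ℂ)) (-1) s :=
      (hasDerivAt_neg s).sub_const _
    exact (hexp.const_cpow (Or.inl (by exact_mod_cast (by linarith : 0 < ‖x‖).ne'))).sub
      (hexp.const_cpow (Or.inl (by exact_mod_cast (by linarith : 0 < q x).ne')))
end
end

section
/- For every D < −2 there exists a Lebesgue measurable set Ω ⊆ ℝ² of finite Lebesgue measure such that dim_B(∞,Ω) exists and equals D, Ω is Minkowski nondegenerate at infinity, and Ω is maximally hyperfractal at infinity: for some (equivalently any) T > 0, for every point z with Re z = D and every open connected neighborhood V of z, there is no function g meromorphic on V that agrees with the distance zeta function ζ_{∞,Ω}(·;T) on V ∩ {Re s > D}; in particular every point of the critical line {Re s = D} is a nonremovable singularity of ζ_{∞,Ω}. -/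
open MeasureTheory Filter Set Complex Topology
open scoped ENNReal Real

noncomputable section

/-- The planar set of points at distance `r > 1` from the origin whose argument lies
strictly between `0` and `h r`. -/
def angularRegion (h : ℝ → ℝ) : Set (EuclideanSpace ℝ (Fin 2)) :=
  {x | 1 < ‖x‖ ∧ (Complex.orthonormalBasisOneI.repr.symm x).arg ∈ Ioo 0 (h ‖x‖)}

theorem measurableSet_angularRegion {h : ℝ → ℝ} (hh : Measurable h) :
    MeasurableSet (angularRegion h) := by
  have harg : Measurable fun x : EuclideanSpace ℝ (Fin 2) =>
      (Complex.orthonormalBasisOneI.repr.symm x).arg :=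
    Complex.measurable_arg.comp (LinearIsometryEquiv.continuous _).measurable
  exact (measurableSet_lt measurable_const measurable_norm).inter
    ((measurableSet_lt measurable_const harg).inter
      (measurableSet_lt harg (hh.comp measurable_norm)))

theorem lintegral_Ioo_indicator_Ioo_zero {c : ℝ} (hc : c ≤ π) (k : ℝ≥0∞) :
    ∫⁻ θ in Ioo (-π) π, (Ioo 0 c).indicator (fun _ => k) θ = k * ENNReal.ofReal c := by
  rw [lintegral_indicator measurableSet_Ioo, Measure.restrict_restrict measurableSet_Ioo,
    inter_eq_left.2 (Ioo_subset_Ioo (by linarith [Real.pi_pos]) hc)]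
  simp

/-- Distribution of the distance to the origin on an angular region. -/
theorem map_norm_restrict_angularRegion {h : ℝ → ℝ} (hh : Measurable h)
    (hπ : ∀ r, 1 < r → h r ≤ π) :
    (volume.restrict (angularRegion h)).map norm =
      (volume.restrict (Ioi 1)).withDensity fun r => ENNReal.ofReal (r * h r) := by
  ext A hA
  have hΩ := measurableSet_angularRegion hh
  set e := Complex.orthonormalBasisOneI.repr with he
  have hS : MeasurableSet (norm ⁻¹' A ∩ angularRegion h) := (measurable_norm hA).inter hΩ
  rw [Measure.map_apply measurable_norm hA, Measure.restrict_apply (measurable_norm hA),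
    withDensity_apply _ hA, Measure.restrict_restrict hA,
    ← e.measurePreserving.measure_preimage hS.nullMeasurableSet,
    ← lintegral_indicator_one (e.continuous.measurable hS),
    ← Complex.lintegral_comp_polarCoord_symm]
  have key : ∀ p ∈ polarCoord.target, ENNReal.ofReal p.1 •
      (e ⁻¹' (norm ⁻¹' A ∩ angularRegion h)).indicator (1 : ℂ → ℝ≥0∞)
        (Complex.polarCoord.symm p) =
      (A ∩ Ioi 1).indicator (fun r => (Ioo 0 (h r)).indicator
        (fun _ => ENNReal.ofReal r) p.2) p.1 := by
    rintro ⟨r, θ⟩ ⟨hr : 0 < r, hθ⟩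
    have hn : ‖Complex.polarCoord.symm (r, θ)‖ = r := by
      rw [Complex.norm_polarCoord_symm, abs_of_pos hr]
    have ha : (Complex.polarCoord.symm (r, θ)).arg = θ := by
      rw [Complex.polarCoord_symm_apply]
      exact_mod_cast Complex.arg_mul_cos_add_sin_mul_I hr (Ioo_subset_Ioc_self hθ)
    have hmem : Complex.polarCoord.symm (r, θ) ∈ e ⁻¹' (norm ⁻¹' A ∩ angularRegion h) ↔
        r ∈ A ∩ Ioi 1 ∧ θ ∈ Ioo 0 (h r) := by
      simp only [angularRegion, mem_preimage, mem_inter_iff, mem_ofPred_eq, ← he,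
        LinearIsometryEquiv.norm_map, LinearIsometryEquiv.symm_apply_apply, hn, ha, mem_Ioi]
      tauto
    by_cases h1 : r ∈ A ∩ Ioi 1
    · by_cases h2 : θ ∈ Ioo 0 (h r)
      · rw [indicator_of_mem (hmem.2 ⟨h1, h2⟩), indicator_of_mem h1, indicator_of_mem h2]
        simp
      · rw [indicator_of_notMem fun H => h2 (hmem.1 H).2, indicator_of_mem h1,
          indicator_of_notMem h2]
        simp
    · rw [indicator_of_notMem fun H => h1 (hmem.1 H).1, indicator_of_notMem h1]
      simp
  rw [setLIntegral_congr_fun polarCoord.open_target.measurableSet key]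
  have hAm : MeasurableSet (A ∩ Ioi (1 : ℝ)) := hA.inter measurableSet_Ioi
  have hmeas : Measurable fun p : ℝ × ℝ => (A ∩ Ioi 1).indicator
      (fun r => (Ioo 0 (h r)).indicator (fun _ => ENNReal.ofReal r) p.2) p.1 := by
    have hB : MeasurableSet {p : ℝ × ℝ | p.1 ∈ A ∩ Ioi 1 ∧ p.2 ∈ Ioo 0 (h p.1)} :=
      (measurable_fst hAm).inter ((measurableSet_lt measurable_const measurable_snd).inter
        (measurableSet_lt measurable_snd (hh.comp measurable_fst)))
    convert (ENNReal.measurable_ofReal.comp measurable_fst).indicator hB using 1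
    ext p
    by_cases h1 : p.1 ∈ A ∩ Ioi 1 <;> by_cases h2 : p.2 ∈ Ioo 0 (h p.1) <;>
      simp only [indicator, h1, h2, mem_ofPred_eq, if_true, if_false, and_true, and_false,
        Function.comp]
  have htarget : polarCoord.target = Ioi (0 : ℝ) ×ˢ Ioo (-π) π := rfl
  rw [htarget, Measure.volume_eq_prod, setLIntegral_prod _ hmeas.aemeasurable]
  have inner : ∀ r, ∫⁻ θ in Ioo (-π) π, (A ∩ Ioi 1).indicator
      (fun r => (Ioo 0 (h r)).indicator (fun _ => ENNReal.ofReal r) θ) r =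
      (A ∩ Ioi 1).indicator (fun r => ENNReal.ofReal (r * h r)) r := by
    intro r
    by_cases h1 : r ∈ A ∩ Ioi 1
    · simp only [indicator_of_mem h1]
      rw [lintegral_Ioo_indicator_Ioo_zero (hπ r h1.2),
        ENNReal.ofReal_mul (zero_le_one.trans (le_of_lt h1.2))]
    · simp [indicator_of_notMem h1]
  simp_rw [inner]
  rw [lintegral_indicator hAm, Measure.restrict_restrict hAm, inter_eq_left.2]
  exact fun r hr => mem_Ioi.2 (zero_lt_one.trans hr.2)

theorem volume_tailSet_angularRegion {h : ℝ → ℝ} (hh : Measurable h)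
    (hπ : ∀ r, 1 < r → h r ≤ π) {t : ℝ} (ht : 1 ≤ t) :
    volume (tailSet 2 (angularRegion h) t) = ∫⁻ r in Ioi t, ENNReal.ofReal (r * h r) := by
  have hset : tailSet 2 (angularRegion h) t = norm ⁻¹' Ici t ∩ angularRegion h := by
    ext x
    exact and_comm
  rw [hset, ← Measure.restrict_apply (measurable_norm measurableSet_Ici),
    ← Measure.map_apply measurable_norm measurableSet_Ici, map_norm_restrict_angularRegion hh hπ,
    withDensity_apply _ measurableSet_Ici, Measure.restrict_restrict measurableSet_Ici]
  refine setLIntegral_congr ?_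
  rcases ht.eq_or_lt with rfl | ht
  · rw [inter_eq_right.2 Ioi_subset_Ici_self]
    exact ae_eq_refl _
  · rw [inter_eq_left.2 (Ici_subset_Ioi.2 ht)]
    exact Ioi_ae_eq_Ici.symm

theorem tailSet_one_angularRegion (h : ℝ → ℝ) :
    tailSet 2 (angularRegion h) 1 = angularRegion h := by
  ext x
  exact ⟨fun hx => hx.1, fun hx => ⟨hx, hx.1.le⟩⟩

theorem distZeta_angularRegion {h : ℝ → ℝ} (hh : Measurable h)
    (h0 : ∀ r, 1 < r → 0 ≤ h r) (hπ : ∀ r, 1 < r → h r ≤ π) (T : ℝ) (s : ℂ) :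
    distZeta 2 (angularRegion h) T s =
      ∫ r in Ioi (max 1 T), ((r * h r : ℝ) : ℂ) * (r : ℂ) ^ (-s - 2) := by
  have hset : tailSet 2 (angularRegion h) T = norm ⁻¹' Ici T ∩ angularRegion h := by
    ext x
    exact and_comm
  have hf : Measurable fun r : ℝ => (r : ℂ) ^ (-s - 2) :=
    Complex.measurable_ofReal.pow_const _
  have hd : Measurable fun r : ℝ => ENNReal.ofReal (r * h r) :=
    ENNReal.measurable_ofReal.comp (measurable_id.mul hh)
  rw [distZeta, hset, ← Measure.restrict_restrict (measurable_norm measurableSet_Ici)]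
  have hmap := setIntegral_map (μ := volume.restrict (angularRegion h))
    (g := norm) (f := fun r : ℝ => (r : ℂ) ^ (-s - 2)) (measurableSet_Ici (a := T))
    hf.aestronglyMeasurable measurable_norm.aemeasurable
  push_cast
  rw [← hmap, map_norm_restrict_angularRegion hh hπ, restrict_withDensity measurableSet_Ici,
    integral_withDensity_eq_integral_toReal_smul hd (ae_of_all _ fun _ => ENNReal.ofReal_lt_top),
    Measure.restrict_restrict measurableSet_Ici]
  have hae : (Ici T ∩ Ioi 1 : Set ℝ) =ᵐ[volume] Ioi (max 1 T) := by
    rw [max_comm, ← Ioi_inter_Ioi]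
    exact Ioi_ae_eq_Ici.symm.inter (ae_eq_refl _)
  rw [setIntegral_congr_set hae]
  refine setIntegral_congr_fun measurableSet_Ioi fun r hr => ?_
  have hr1 : 1 < r := (le_max_left _ _).trans_lt hr
  simp only [ENNReal.toReal_ofReal (mul_nonneg (by linarith) (h0 r hr1)), Complex.real_smul]
  push_cast
  rfl

theorem ENNReal.ofReal_mul_rpow_div_ofReal_rpow {c t : ℝ} (ht : 0 < t) (a b : ℝ) :
    ENNReal.ofReal (c * t ^ a) / ENNReal.ofReal (t ^ b) = ENNReal.ofReal (c * t ^ (a - b)) := by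
  rw [← ENNReal.ofReal_div_of_pos (Real.rpow_pos_of_pos ht b), mul_div_assoc, Real.rpow_sub ht]

section TubeBounds

variable {N : ℕ} {Ω : Set (EuclideanSpace ℝ (Fin N))} {D c C : ℝ}

theorem ofReal_le_lowerMinkContent {r : ℝ} (hc : 0 ≤ c) (hr : r ≤ D)
    (hlow : ∀ t, 1 ≤ t → ENNReal.ofReal (c * t ^ ((N : ℝ) + D)) ≤ volume (tailSet N Ω t)) :
    ENNReal.ofReal c ≤ lowerMinkContent N Ω r := by
  refine le_liminf_of_le (by isBoundedDefault) ?_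
  filter_upwards [eventually_ge_atTop 1] with t ht
  have ht0 : 0 < t := zero_lt_one.trans_le ht
  calc ENNReal.ofReal c ≤ ENNReal.ofReal (c * t ^ ((N + D) - (N + r) : ℝ)) :=
        ENNReal.ofReal_le_ofReal <| le_mul_of_one_le_right hc <|
          Real.one_le_rpow ht (by linarith)
    _ ≤ _ := by
        rw [← ENNReal.ofReal_mul_rpow_div_ofReal_rpow ht0]
        exact ENNReal.div_le_div_right (hlow t ht) _

theorem upperMinkContent_le_ofReal
    (hup : ∀ t, 1 ≤ t → volume (tailSet N Ω t) ≤ ENNReal.ofReal (C * t ^ ((N : ℝ) + D))) :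
    upperMinkContent N Ω D ≤ ENNReal.ofReal C := by
  refine limsup_le_of_le (by isBoundedDefault) ?_
  filter_upwards [eventually_ge_atTop 1] with t ht
  have ht0 : 0 < t := zero_lt_one.trans_le ht
  refine (ENNReal.div_le_div_right (hup t ht) _).trans_eq ?_
  rw [ENNReal.ofReal_mul_rpow_div_ofReal_rpow ht0, sub_self, Real.rpow_zero, mul_one]

theorem upperMinkContent_eq_zero {r : ℝ} (hr : D < r)
    (hup : ∀ t, 1 ≤ t → volume (tailSet N Ω t) ≤ ENNReal.ofReal (C * t ^ ((N : ℝ) + D))) :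
    upperMinkContent N Ω r = 0 := by
  have hlim : Tendsto (fun t : ℝ => ENNReal.ofReal (C * t ^ ((N + D) - (N + r) : ℝ))) atTop
      (𝓝 0) := by
    have h := (tendsto_rpow_neg_atTop (sub_pos.2 hr)).const_mul C
    rw [mul_zero] at h
    rw [← ENNReal.ofReal_zero]
    refine (ENNReal.continuous_ofReal.tendsto 0).comp (h.congr fun t => ?_)
    congr 2
    ring
  refine Tendsto.limsup_eq (tendsto_of_tendsto_of_tendsto_of_le_of_le' tendsto_const_nhds hlim
    (Eventually.of_forall fun _ => zero_le) ?_)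
  filter_upwards [eventually_ge_atTop 1] with t ht
  rw [← ENNReal.ofReal_mul_rpow_div_ofReal_rpow (zero_lt_one.trans_le ht)]
  exact ENNReal.div_le_div_right (hup t ht) _

theorem lowerMinkContent_le_upperMinkContent (r : ℝ) :
    lowerMinkContent N Ω r ≤ upperMinkContent N Ω r :=
  liminf_le_limsup

theorem minkDim_eq_of_tube_bounds (hc : 0 < c)
    (hlow : ∀ t, 1 ≤ t → ENNReal.ofReal (c * t ^ ((N : ℝ) + D)) ≤ volume (tailSet N Ω t))
    (hup : ∀ t, 1 ≤ t → volume (tailSet N Ω t) ≤ ENNReal.ofReal (C * t ^ ((N : ℝ) + D))) :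
    lowerMinkDim N Ω = D ∧ upperMinkDim N Ω = D := by
  have hpos : ∀ r, r ≤ D → 0 < lowerMinkContent N Ω r := fun r hr =>
    (ENNReal.ofReal_pos.2 hc).trans_le (ofReal_le_lowerMinkContent hc.le hr hlow)
  constructor
  · have : {r : ℝ | lowerMinkContent N Ω r = 0} = Ioi D := by
      ext r
      refine ⟨fun h => mem_Ioi.2 (not_le.1 fun hr => (hpos r hr).ne' h), fun h => ?_⟩
      exact le_antisymm ((lowerMinkContent_le_upperMinkContent r).trans
        (upperMinkContent_eq_zero h hup).le) zero_le
    rw [lowerMinkDim, this, csInf_Ioi]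
  · have : {r : ℝ | upperMinkContent N Ω r = 0} = Ioi D := by
      ext r
      refine ⟨fun h => mem_Ioi.2 (not_le.1 fun hr => ?_), fun h => upperMinkContent_eq_zero h hup⟩
      exact ((hpos r hr).trans_le (lowerMinkContent_le_upperMinkContent r)).ne' h
    rw [upperMinkDim, this, csInf_Ioi]

end TubeBounds

/-- A positive almost periodic function whose frequencies are dense in `ℝ`. -/
def almostPeriodicProfile (u : ℝ) : ℝ :=
  ∑' k : ℕ, (1 / 2) ^ (k + 1) * (2 + Real.cos (TopologicalSpace.denseSeq ℝ k * u))

theorem hasSum_half_pow_succ : HasSum (fun k : ℕ => (1 / 2 : ℝ) ^ (k + 1)) 1 := by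
  simpa [pow_succ] using hasSum_geometric_two.mul_right (1 / 2 : ℝ)

theorem two_add_cos_mem_Icc (x : ℝ) : 2 + Real.cos x ∈ Icc (1 : ℝ) 3 :=
  ⟨by linarith [Real.neg_one_le_cos x], by linarith [Real.cos_le_one x]⟩

theorem abs_almostPeriodicProfile_term_le (k : ℕ) (u : ℝ) :
    |(1 / 2) ^ (k + 1) * (2 + Real.cos (TopologicalSpace.denseSeq ℝ k * u))| ≤
      (1 / 2) ^ (k + 1) * 3 := by
  obtain ⟨h1, h3⟩ := two_add_cos_mem_Icc (TopologicalSpace.denseSeq ℝ k * u)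
  rw [abs_of_nonneg (by positivity)]
  gcongr

theorem summable_almostPeriodicProfile (u : ℝ) :
    Summable fun k : ℕ =>
      (1 / 2) ^ (k + 1) * (2 + Real.cos (TopologicalSpace.denseSeq ℝ k * u)) :=
  (hasSum_half_pow_succ.summable.mul_right 3).of_norm_bounded
    (abs_almostPeriodicProfile_term_le · u)

theorem continuous_almostPeriodicProfile : Continuous almostPeriodicProfile :=
  continuous_tsum (fun k => by fun_prop) (hasSum_half_pow_succ.summable.mul_right 3)
    abs_almostPeriodicProfile_term_le

theorem almostPeriodicProfile_mem_Icc (u : ℝ) : almostPeriodicProfile u ∈ Icc (1 : ℝ) 3 := by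
  constructor
  · refine hasSum_le (fun k => ?_) hasSum_half_pow_succ (summable_almostPeriodicProfile u).hasSum
    exact le_mul_of_one_le_right (by positivity) (two_add_cos_mem_Icc _).1
  · have h := hasSum_half_pow_succ.mul_right 3
    rw [one_mul] at h
    exact hasSum_le (fun k => (le_abs_self _).trans (abs_almostPeriodicProfile_term_le k u))
      (summable_almostPeriodicProfile u).hasSum h

theorem norm_almostPeriodicProfile_mul_cpow_le {r : ℝ} (hr : 0 < r) (u : ℝ) (a : ℂ) :
    ‖(almostPeriodicProfile u : ℂ) * (r : ℂ) ^ a‖ ≤ 3 * r ^ a.re := by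
  obtain ⟨h1, h3⟩ := almostPeriodicProfile_mem_Icc u
  rw [norm_mul, Complex.norm_cpow_eq_rpow_re_of_pos hr, Complex.norm_real, Real.norm_eq_abs,
    abs_of_nonneg (by linarith)]
  gcongr

theorem integral_Ioi_one_cpow_neg_one_sub {w : ℂ} (hw : 0 < w.re) :
    ∫ r in Ioi (1 : ℝ), (r : ℂ) ^ (-1 - w) = w⁻¹ := by
  rw [integral_Ioi_cpow_of_lt (by simpa using hw) one_pos]
  have : -1 - w + 1 = -w := by ring
  rw [this, Complex.ofReal_one, Complex.one_cpow, neg_div_neg_eq, one_div]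

theorem integrableOn_Ioi_one_cpow_neg_one_sub {w : ℂ} (hw : 0 < w.re) :
    IntegrableOn (fun r : ℝ => (r : ℂ) ^ (-1 - w)) (Ioi 1) :=
  integrableOn_Ioi_cpow_of_lt (by simpa using hw) one_pos

theorem ofReal_two_add_cos_log_mul_cpow {r : ℝ} (hr : 0 < r) (ω : ℝ) (w : ℂ) :
    ((2 + Real.cos (ω * Real.log r) : ℝ) : ℂ) * (r : ℂ) ^ (-1 - w) =
      2 * (r : ℂ) ^ (-1 - w) + (1 / 2) * ((r : ℂ) ^ (-1 - (w - ω * I)) +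
        (r : ℂ) ^ (-1 - (w + ω * I))) := by
  have hr' : (r : ℂ) ≠ 0 := by exact_mod_cast hr.ne'
  have h1 : -1 - (w - ω * I) = (-1 - w) + ω * I := by ring
  have h2 : -1 - (w + ω * I) = (-1 - w) + -(ω * I) := by ring
  rw [h1, h2, Complex.cpow_add _ _ hr', Complex.cpow_add _ _ hr',
    Complex.cpow_def_of_ne_zero hr' (ω * I),
    Complex.cpow_def_of_ne_zero hr' (-(ω * I)), ← Complex.ofReal_log hr.le]
  push_cast
  rw [Complex.cos]
  ring_nf

theorem integral_two_add_cos_log_mul_cpow (ω : ℝ) {w : ℂ} (hw : 0 < w.re) :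
    IntegrableOn (fun r : ℝ => ((2 + Real.cos (ω * Real.log r) : ℝ) : ℂ) * (r : ℂ) ^ (-1 - w))
      (Ioi 1) ∧
    ∫ r in Ioi (1 : ℝ), ((2 + Real.cos (ω * Real.log r) : ℝ) : ℂ) * (r : ℂ) ^ (-1 - w) =
      2 * w⁻¹ + (1 / 2) * ((w - ω * I)⁻¹ + (w + ω * I)⁻¹) := by
  have hm : 0 < (w - ω * I).re := by simpa using hw
  have hp : 0 < (w + ω * I).re := by simpa using hw
  have i0 := (integrableOn_Ioi_one_cpow_neg_one_sub hw).const_mul 2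
  have im := integrableOn_Ioi_one_cpow_neg_one_sub hm
  have ip := integrableOn_Ioi_one_cpow_neg_one_sub hp
  have heq : EqOn (fun r : ℝ => ((2 + Real.cos (ω * Real.log r) : ℝ) : ℂ) * (r : ℂ) ^ (-1 - w))
      (fun r : ℝ => 2 * (r : ℂ) ^ (-1 - w) + (1 / 2) * ((r : ℂ) ^ (-1 - (w - ω * I)) +
        (r : ℂ) ^ (-1 - (w + ω * I)))) (Ioi 1) := fun r hr =>
    ofReal_two_add_cos_log_mul_cpow (zero_lt_one.trans hr) ω w
  refine ⟨(integrableOn_congr_fun heq measurableSet_Ioi).2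
    (i0.add ((im.add ip).const_mul (1 / 2))), ?_⟩
  rw [setIntegral_congr_fun measurableSet_Ioi heq]
  have e1 := integral_add i0 ((im.add ip).const_mul (1 / 2))
  have e2 := integral_add im ip
  simp only [Pi.add_apply] at e1
  rw [e1, integral_const_mul, integral_const_mul, e2, integral_Ioi_one_cpow_neg_one_sub hw,
    integral_Ioi_one_cpow_neg_one_sub hm, integral_Ioi_one_cpow_neg_one_sub hp]

theorem Complex.inv_re_nonneg {w : ℂ} (hw : 0 ≤ w.re) : 0 ≤ (w⁻¹).re := by
  rw [Complex.inv_re]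
  exact div_nonneg hw (Complex.normSq_nonneg w)

/-- The Mellin transform of the profile blows up at each frequency. -/
theorem le_re_integral_almostPeriodicProfile (j : ℕ) {ε : ℝ} (hε : 0 < ε) :
    (1 / 2) ^ (j + 2) * ε⁻¹ ≤
      (∫ r in Ioi (1 : ℝ), (almostPeriodicProfile (Real.log r) : ℂ) *
        (r : ℂ) ^ (-1 - (ε + TopologicalSpace.denseSeq ℝ j * I))).re := by
  set w : ℂ := ε + TopologicalSpace.denseSeq ℝ j * I with hwdef
  have hwre : w.re = ε := by simp [hwdef]
  have hw : 0 < w.re := hwre.symm ▸ hε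
  set F : ℕ → ℝ → ℂ := fun k r => (((1 / 2) ^ (k + 1) : ℝ) : ℂ) *
    (((2 + Real.cos (TopologicalSpace.denseSeq ℝ k * Real.log r) : ℝ) : ℂ) *
      (r : ℂ) ^ (-1 - w)) with hF
  have hFint : ∀ k, Integrable (F k) (volume.restrict (Ioi 1)) := fun k =>
    (integral_two_add_cos_log_mul_cpow (TopologicalSpace.denseSeq ℝ k) hw).1.const_mul _
  have hdom : IntegrableOn (fun r : ℝ => r ^ (-1 - ε)) (Ioi 1) :=
    integrableOn_Ioi_rpow_of_lt (by linarith) one_pos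
  have hFnorm : ∀ k, ∫ r in Ioi 1, ‖F k r‖ ≤
      (1 / 2) ^ (k + 1) * (3 * ∫ r in Ioi (1 : ℝ), r ^ (-1 - ε)) := by
    intro k
    rw [← mul_assoc, ← integral_const_mul]
    refine setIntegral_mono_on (hFint k).norm (hdom.const_mul _) measurableSet_Ioi fun r hr => ?_
    rw [hF]
    simp only
    rw [← mul_assoc, ← Complex.ofReal_mul, norm_mul, Complex.norm_real, Real.norm_eq_abs,
      Complex.norm_cpow_eq_rpow_re_of_pos (zero_lt_one.trans hr)]
    have hre : (-1 - w).re = -1 - ε := by simp [hwre]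
    rw [hre]
    exact mul_le_mul_of_nonneg_right (abs_almostPeriodicProfile_term_le k _)
      (Real.rpow_nonneg (zero_lt_one.trans hr).le _)
  have hsum := hasSum_integral_of_summable_integral_norm hFint
    ((hasSum_half_pow_succ.summable.mul_right _).of_nonneg_of_le
      (fun k => integral_nonneg fun r => norm_nonneg _) hFnorm)
  have htsum : ∀ r : ℝ, ∑' k, F k r =
      (almostPeriodicProfile (Real.log r) : ℂ) * (r : ℂ) ^ (-1 - w) := by
    intro r
    simp only [hF, ← mul_assoc, ← Complex.ofReal_mul]
    rw [tsum_mul_right, ← Complex.ofReal_tsum]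
    rfl
  simp only [htsum] at hsum
  have hre := Complex.hasSum_re hsum
  have hterm : ∀ k, (∫ r in Ioi 1, F k r).re = (1 / 2) ^ (k + 1) * (2 * (w⁻¹).re +
      (1 / 2) * (((w - TopologicalSpace.denseSeq ℝ k * I)⁻¹).re +
        ((w + TopologicalSpace.denseSeq ℝ k * I)⁻¹).re)) := by
    intro k
    simp only [hF]
    rw [integral_const_mul, (integral_two_add_cos_log_mul_cpow _ hw).2, Complex.re_ofReal_mul]
    have h2 : (2 : ℂ) = ((2 : ℝ) : ℂ) := by norm_cast
    have h12 : (1 / 2 : ℂ) = ((1 / 2 : ℝ) : ℂ) := by push_cast; rfl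
    rw [Complex.add_re, h12, h2, Complex.re_ofReal_mul, Complex.re_ofReal_mul, Complex.add_re]
  have h0 := Complex.inv_re_nonneg hw.le
  have hm : ∀ k, 0 ≤ ((w - TopologicalSpace.denseSeq ℝ k * I)⁻¹).re := fun k =>
    Complex.inv_re_nonneg (by simpa using hw.le)
  have hp : ∀ k, 0 ≤ ((w + TopologicalSpace.denseSeq ℝ k * I)⁻¹).re := fun k =>
    Complex.inv_re_nonneg (by simpa using hw.le)
  refine le_trans ?_ (le_hasSum hre j fun k _ => ?_)
  · have hj : ((w - TopologicalSpace.denseSeq ℝ j * I)⁻¹).re = ε⁻¹ := by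
      rw [hwdef, add_sub_cancel_right, ← Complex.ofReal_inv, Complex.ofReal_re]
    rw [hterm, hj, pow_succ _ (j + 1), mul_assoc]
    have := hp j
    gcongr
    linarith
  · rw [hterm]
    have := hp k
    have := hm k
    positivity

/-- The angular width of the maximally hyperfractal set of dimension `D`. -/
def hyperfractalWidth (D r : ℝ) : ℝ :=
  r ^ D * almostPeriodicProfile (Real.log r)

theorem measurable_hyperfractalWidth (D : ℝ) : Measurable (hyperfractalWidth D) :=
  (measurable_id.pow_const D).mul
    (continuous_almostPeriodicProfile.measurable.comp Real.measurable_log)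

theorem hyperfractalWidth_nonneg (D : ℝ) {r : ℝ} (hr : 1 < r) : 0 ≤ hyperfractalWidth D r :=
  mul_nonneg (Real.rpow_nonneg (by linarith) _)
    (zero_le_one.trans (almostPeriodicProfile_mem_Icc _).1)

theorem hyperfractalWidth_le_pi {D : ℝ} (hD : D ≤ 0) {r : ℝ} (hr : 1 < r) :
    hyperfractalWidth D r ≤ π := by
  obtain ⟨h1, h3⟩ := almostPeriodicProfile_mem_Icc (Real.log r)
  calc hyperfractalWidth D r ≤ 1 * 3 :=
        mul_le_mul (Real.rpow_le_one_of_one_le_of_nonpos hr.le hD) h3 (by linarith) zero_le_one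
    _ ≤ π := by linarith [Real.pi_gt_three]

theorem lintegral_Ioi_ofReal_mul_rpow {a t c : ℝ} (ha : a < -1) (ht : 0 < t) (hc : 0 ≤ c) :
    ∫⁻ r in Ioi t, ENNReal.ofReal (c * r ^ a) =
      ENNReal.ofReal (c / (-(a + 1)) * t ^ (a + 1)) := by
  rw [← ofReal_integral_eq_lintegral_ofReal
    ((integrableOn_Ioi_rpow_of_lt ha ht).const_mul c), integral_const_mul,
    integral_Ioi_rpow_of_lt ha ht]
  · congr 1
    have : a + 1 ≠ 0 := by linarith
    field_simp
  · filter_upwards [ae_restrict_mem measurableSet_Ioi] with r hr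
    exact mul_nonneg hc (Real.rpow_nonneg (ht.trans hr).le _)

theorem mul_hyperfractalWidth {D r : ℝ} (hr : 0 < r) :
    r * hyperfractalWidth D r = almostPeriodicProfile (Real.log r) * r ^ (D + 1) := by
  rw [hyperfractalWidth, Real.rpow_add_one hr.ne']
  ring

theorem volume_tailSet_hyperfractal_bounds {D : ℝ} (hD : D < -2) {t : ℝ} (ht : 1 ≤ t) :
    ENNReal.ofReal (1 / (-(D + 2)) * t ^ (((2 : ℕ) : ℝ) + D)) ≤
        volume (tailSet 2 (angularRegion (hyperfractalWidth D)) t) ∧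
      volume (tailSet 2 (angularRegion (hyperfractalWidth D)) t) ≤
        ENNReal.ofReal (3 / (-(D + 2)) * t ^ (((2 : ℕ) : ℝ) + D)) := by
  have ht0 : 0 < t := zero_lt_one.trans_le ht
  have e1 : D + 2 = D + 1 + 1 := by ring
  have e2 : ((2 : ℕ) : ℝ) + D = D + 1 + 1 := by push_cast; ring
  rw [volume_tailSet_angularRegion (measurable_hyperfractalWidth D)
    (fun r hr => hyperfractalWidth_le_pi (by linarith) hr) ht, e1, e2,
    ← lintegral_Ioi_ofReal_mul_rpow (by linarith) ht0 zero_le_one,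
    ← lintegral_Ioi_ofReal_mul_rpow (by linarith) ht0 (by norm_num)]
  constructor <;> refine setLIntegral_mono' measurableSet_Ioi fun r hr =>
    ENNReal.ofReal_le_ofReal ?_ <;> rw [mul_hyperfractalWidth (ht0.trans hr)] <;>
    refine mul_le_mul_of_nonneg_right ?_ (Real.rpow_nonneg (ht0.trans hr).le _)
  · exact (almostPeriodicProfile_mem_Icc _).1
  · exact (almostPeriodicProfile_mem_Icc _).2

theorem distZeta_hyperfractal {D : ℝ} (hD : D ≤ 0) (T : ℝ) (w : ℂ) :
    distZeta 2 (angularRegion (hyperfractalWidth D)) T (D + w) =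
      ∫ r in Ioi (max 1 T), (almostPeriodicProfile (Real.log r) : ℂ) * (r : ℂ) ^ (-1 - w) := by
  rw [distZeta_angularRegion (measurable_hyperfractalWidth D)
    (fun r hr => hyperfractalWidth_nonneg D hr) (fun r hr => hyperfractalWidth_le_pi hD hr)]
  refine setIntegral_congr_fun measurableSet_Ioi fun r hr => ?_
  have hr0 : 0 < r := zero_lt_one.trans ((le_max_left _ _).trans_lt hr)
  have hr' : (r : ℂ) ≠ 0 := by exact_mod_cast hr0.ne'
  simp only [mul_hyperfractalWidth hr0]
  rw [Complex.ofReal_mul, Complex.ofReal_cpow hr0.le, mul_assoc, ← Complex.cpow_add _ _ hr']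
  congr 2
  push_cast
  ring

/-- The distance zeta function is unbounded near `D + ω I` for each frequency `ω`. -/
theorem le_re_distZeta_hyperfractal {D : ℝ} (hD : D ≤ 0) (T : ℝ) (j : ℕ) {ε : ℝ} (hε : 0 < ε) :
    (1 / 2) ^ (j + 2) * ε⁻¹ - 3 * (max 1 T - 1) ≤
      (distZeta 2 (angularRegion (hyperfractalWidth D)) T
        (D + (ε + TopologicalSpace.denseSeq ℝ j * I))).re := by
  rw [distZeta_hyperfractal hD]
  set w : ℂ := ε + TopologicalSpace.denseSeq ℝ j * I with hw
  have hwre : (-1 - w).re = -1 - ε := by simp [hw]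
  set f : ℝ → ℂ := fun r => (almostPeriodicProfile (Real.log r) : ℂ) * (r : ℂ) ^ (-1 - w)
    with hf
  have hfm : Measurable f := (Complex.measurable_ofReal.comp
    (continuous_almostPeriodicProfile.measurable.comp Real.measurable_log)).mul
      (Complex.measurable_ofReal.pow_const _)
  have hbound : ∀ r ∈ Ioi (1 : ℝ), ‖f r‖ ≤ 3 * r ^ (-1 - ε) := fun r hr =>
    hwre ▸ norm_almostPeriodicProfile_mul_cpow_le (zero_lt_one.trans hr) _ _
  have hint : IntegrableOn f (Ioi 1) :=
    ((integrableOn_Ioi_rpow_of_lt (by linarith : -1 - ε < -1) one_pos).const_mul 3).mono'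
      hfm.aestronglyMeasurable (by
        filter_upwards [ae_restrict_mem measurableSet_Ioi] with r hr using hbound r hr)
  have ha : 1 ≤ max 1 T := le_max_left _ _
  have hsplit : ∫ r in Ioi 1, f r =
      (∫ r in Ioc 1 (max 1 T), f r) + ∫ r in Ioi (max 1 T), f r := by
    rw [← Ioc_union_Ioi_eq_Ioi ha]
    exact setIntegral_union Ioc_disjoint_Ioi_same measurableSet_Ioi
      (hint.mono_set Ioc_subset_Ioi_self) (hint.mono_set (Ioi_subset_Ioi ha))
  have hsmall : ‖∫ r in Ioc 1 (max 1 T), f r‖ ≤ 3 * (max 1 T - 1) := by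
    refine (norm_setIntegral_le_of_norm_le_const (C := 3) (by simp) fun r hr =>
      (hbound r hr.1).trans ?_).trans_eq ?_
    · have := Real.rpow_le_one_of_one_le_of_nonpos hr.1.le (by linarith : -1 - ε ≤ 0)
      linarith
    · rw [Real.volume_real_Ioc_of_le ha]
  have hmain := le_re_integral_almostPeriodicProfile j hε
  rw [← hw] at hmain
  change _ ≤ (∫ r in Ioi 1, f r).re at hmain
  rw [hsplit, Complex.add_re] at hmain
  linarith [(Complex.re_le_norm _).trans hsmall]

theorem tendsto_re_distZeta_hyperfractal {D : ℝ} (hD : D ≤ 0) (T : ℝ) (j : ℕ) :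
    Tendsto (fun ε : ℝ => (distZeta 2 (angularRegion (hyperfractalWidth D)) T
      (D + (ε + TopologicalSpace.denseSeq ℝ j * I))).re) (𝓝[>] 0) atTop := by
  refine tendsto_atTop_mono' _ ?_ (tendsto_atTop_add_const_right _ (-(3 * (max 1 T - 1)))
    (tendsto_inv_nhdsGT_zero.const_mul_atTop (by positivity : (0 : ℝ) < (1 / 2) ^ (j + 2))))
  filter_upwards [self_mem_nhdsWithin] with ε hε
  exact le_re_distZeta_hyperfractal hD T j hε

/-- existence of a maximally hyperfractal set at infinity with prescribed
Minkowski dimension `D < −2`: a set `Ω ⊆ ℝ²` of finite measure with `dim_B(∞,Ω) = D`,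
Minkowski nondegenerate at infinity, such that no point `z` of the critical line
`{Re s = D}` admits an open connected neighborhood `V` carrying a meromorphic function
(holomorphic off a set that is discrete and closed in `V`) agreeing with the distance zeta
function on `V ∩ {Re s > D}`. -/
theorem exists_maximally_hyperfractal_at_infinity (D : ℝ) (hD : D < -2) :
    ∃ Ω : Set (EuclideanSpace ℝ (Fin 2)),
      MeasurableSet Ω ∧ volume Ω < ⊤ ∧
      lowerMinkDim 2 Ω = D ∧ upperMinkDim 2 Ω = D ∧
      0 < lowerMinkContent 2 Ω D ∧ upperMinkContent 2 Ω D < ⊤ ∧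
      ∀ T : ℝ, 0 < T → ∀ z : ℂ, z.re = D →
        ∀ V : Set ℂ, IsOpen V → IsConnected V → z ∈ V →
          ¬ ∃ (g : ℂ → ℂ) (S : Set ℂ),
              (∀ w ∈ V, ∃ ε > (0 : ℝ), Metric.ball w ε ∩ S ⊆ {w}) ∧
              DifferentiableOn ℂ g (V \ S) ∧
              (∀ s ∈ V, D < s.re → g s = distZeta 2 Ω T s) := by
  have hD0 : D ≤ 0 := by linarith
  have hc : 0 < 1 / (-(D + 2)) := one_div_pos.2 (by linarith)
  have hlow := fun t ht => (volume_tailSet_hyperfractal_bounds hD (t := t) ht).1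
  have hup := fun t ht => (volume_tailSet_hyperfractal_bounds hD (t := t) ht).2
  obtain ⟨hdl, hdu⟩ := minkDim_eq_of_tube_bounds hc hlow hup
  refine ⟨angularRegion (hyperfractalWidth D),
    measurableSet_angularRegion (measurable_hyperfractalWidth D), ?_, hdl, hdu,
    (ENNReal.ofReal_pos.2 hc).trans_le (ofReal_le_lowerMinkContent hc.le le_rfl hlow),
    (upperMinkContent_le_ofReal hup).trans_lt ENNReal.ofReal_lt_top, ?_⟩
  · rw [← tailSet_one_angularRegion]
    exact (hup 1 le_rfl).trans_lt ENNReal.ofReal_lt_top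
  rintro T - z hz V hV - hzV ⟨g, S, hS, hg, hgζ⟩
  obtain ⟨δ₁, hδ₁, hball₁⟩ := hS z hzV
  obtain ⟨δ₂, hδ₂, hball₂⟩ := Metric.isOpen_iff.1 hV z hzV
  have hpunct : Metric.ball z (min δ₁ δ₂) \ {z} ⊆ V \ S := fun s hs =>
    ⟨hball₂ (Metric.ball_subset_ball (min_le_right _ _) hs.1), fun hsS =>
      hs.2 (hball₁ ⟨Metric.ball_subset_ball (min_le_left _ _) hs.1, hsS⟩)⟩
  have hδ : 0 < min δ₁ δ₂ := lt_min hδ₁ hδ₂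
  obtain ⟨j, hj⟩ := (TopologicalSpace.denseRange_denseSeq ℝ).exists_mem_open isOpen_Ioo
    (nonempty_Ioo.2 (lt_add_of_pos_right z.im hδ))
  set ω := TopologicalSpace.denseSeq ℝ j
  have hw₀ : (D + ω * I : ℂ) ∈ Metric.ball z (min δ₁ δ₂) \ {z} := by
    have hsub : (D + ω * I : ℂ) - z = ((ω - z.im : ℝ) : ℂ) * I := by
      apply Complex.ext <;> simp [hz]
    refine ⟨?_, fun h => hj.1.ne' ?_⟩
    · rw [mem_ball_iff_norm, hsub, norm_mul, Complex.norm_I, mul_one, Complex.norm_real,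
        Real.norm_eq_abs, abs_of_pos (sub_pos.2 hj.1)]
      linarith [hj.2]
    · simpa using congrArg Complex.im h
  have hopen : IsOpen (Metric.ball z (min δ₁ δ₂) \ {z}) :=
    Metric.isOpen_ball.sdiff isClosed_singleton
  have hcont : ContinuousAt g (D + ω * I) :=
    ((hg.mono hpunct).differentiableAt (hopen.mem_nhds hw₀)).continuousAt
  have hpath : Tendsto (fun ε : ℝ => (D + (ε + ω * I) : ℂ)) (𝓝[>] 0) (𝓝 (D + ω * I)) := by
    have : Continuous fun ε : ℝ => (D + (ε + ω * I) : ℂ) := by fun_prop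
    simpa using (this.tendsto 0).mono_left nhdsWithin_le_nhds
  have hlim := (Complex.continuous_re.tendsto _).comp (hcont.tendsto.comp hpath)
  refine not_tendsto_nhds_of_tendsto_atTop (tendsto_re_distZeta_hyperfractal hD0 T j) _
    (hlim.congr' ?_)
  filter_upwards [hpath.eventually (hopen.mem_nhds hw₀), self_mem_nhdsWithin] with ε hε hε0
  exact congrArg Complex.re (hgζ _ (hpunct hε).1 (by simpa using hε0))
end
end
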